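/- arXiv:2007.07302 — 2 statements merged into one kernel-verified Lean document; each statement's English description precedes it below -/
import Mathlib

section
/- Dual-test function as an information projection: let P ∈ int(𝒫), let η > 0 componentwise, let x′ ∈ X̃_d(P) be a deceitful arm, and let μ = (α,β,λ) ∈ ℝ_+ × ℝ × 𝒦* be a dual feasible vector. Then max_{ρ≥0} Dual(η,x′,P;ρ·μ) equals the minimum of Σ_{x∈X̃(P)} η(x)·I(P(x),Q(x)) over all Q ∈ H(x′,P;μ), where H(x′,P;μ) = { Q : Q(x*(P)) = P(x*(P)) and Σ_{x∈X,r∈𝔯} Q(r,x)·(λ(r,x) + β + α·r·1(x=x′)) ≥ β·|X| + α·Rew*(P) }. -/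
open scoped BigOperators Classical
open Filter

namespace Bandit

/-- Matrices indexed by rewards and arms; a reward distribution is such a matrix. -/
abbrev RMat (R X : Type*) := R → X → ℝ

section Core

variable {R X : Type*} [Fintype R] [Fintype X] [Nonempty X]

/-- The set `𝒫_Ω` of all reward distributions. -/
def POmega : Set (RMat R X) :=
  {Q | (∀ r x, 0 ≤ Q r x) ∧ ∀ x : X, ∑ r : R, Q r x = 1}

/-- The interior of `T` in the topology relative to `S`. -/
def relIntIn (S T : Set (RMat R X)) : Set (RMat R X) :=
  {Q | Q ∈ T ∧ ∃ U : Set (RMat R X), IsOpen U ∧ Q ∈ U ∧ U ∩ S ⊆ T}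

/-- Information distance `I(M', M)` between two nonnegative measures on a finite set. -/
noncomputable def infoDiv {α : Type*} [Fintype α] (M' M : α → ℝ) : EReal :=
  if ∀ a, M a = 0 → M' a = 0 then
    ((∑ a : α, (M' a * Real.log (M' a / M a) - M' a + M a) : ℝ) : EReal)
  else ⊤

/-- Expected reward of arm `x` under reward distribution `Q` (reward values `v`). -/
def rewOf (v : R → ℝ) (Q : RMat R X) (x : X) : ℝ := ∑ r : R, v r * Q r x

/-- Optimal expected reward `Rew*`. -/
noncomputable def rewStar (v : R → ℝ) (Q : RMat R X) : ℝ :=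
  Finset.univ.sup' Finset.univ_nonempty (rewOf v Q)

/-- The set `x*(Q)` of optimal arms. -/
def optArms (v : R → ℝ) (Q : RMat R X) : Set X := {x | rewOf v Q x = rewStar v Q}

/-- The set `X̃(Q)` of suboptimal arms. -/
def subArms (v : R → ℝ) (Q : RMat R X) : Set X := {x | rewOf v Q x ≠ rewStar v Q}

noncomputable def optFinset (v : R → ℝ) (Q : RMat R X) : Finset X :=
  Finset.univ.filter fun x => rewOf v Q x = rewStar v Q

noncomputable def subFinset (v : R → ℝ) (Q : RMat R X) : Finset X :=
  Finset.univ.filter fun x => rewOf v Q x ≠ rewStar v Q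

/-- The suboptimality gap `Δ(x, Q)`. -/
noncomputable def gapOf (v : R → ℝ) (Q : RMat R X) (x : X) : ℝ := rewStar v Q - rewOf v Q x

/-- The set `Deceit(x', P)` of deceitful reward distributions. -/
def DeceitSet (v : R → ℝ) (PP : Set (RMat R X)) (x' : X) (P : RMat R X) :
    Set (RMat R X) :=
  {Q | Q ∈ PP ∧ (∀ x ∈ optArms v P, ∀ r, Q r x = P r x) ∧
    ∀ x ∈ optArms v P, rewOf v Q x < rewOf v Q x'}

/-- The objective `Σ_{x ∈ X̃(P)} η(x)·I(P(x), Q(x))`. -/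
noncomputable def distObj (v : R → ℝ) (η : X → ℝ) (P Q : RMat R X) : EReal :=
  ∑ x ∈ subFinset v P, ((η x : ℝ) : EReal) * infoDiv (fun r => P r x) (fun r => Q r x)

/-- The distance function `Dist(η, x', P)` (equal to `⊤` if `Deceit(x', P)` is empty). -/
noncomputable def DistFn (v : R → ℝ) (PP : Set (RMat R X)) (η : X → ℝ) (x' : X)
    (P : RMat R X) : EReal :=
  sInf (distObj v η P '' DeceitSet v PP x' P)

/-- The regret lower bound `C(P)`. -/
noncomputable def CFn (v : R → ℝ) (PP : Set (RMat R X)) (P : RMat R X) : EReal :=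
  sInf {c : EReal | ∃ η : X → ℝ, (∀ x, 0 ≤ η x) ∧
    (∀ x ∈ subArms v P, 1 ≤ DistFn v PP η x P) ∧
    c = ((∑ x ∈ subFinset v P, η x * gapOf v P x : ℝ) : EReal)}

/-- The maximal reward `Rew_max(x', P)` of arm `x'`. -/
noncomputable def rewMax (v : R → ℝ) (PP : Set (RMat R X)) (x' : X) (P : RMat R X) : ℝ :=
  sSup {c : ℝ | ∃ Q ∈ PP, (∀ x ∈ optArms v P, ∀ r, Q r x = P r x) ∧ c = rewOf v Q x'}

/-- The set `X̃_d(P)` of deceitful arms. -/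
def deceitArms (v : R → ℝ) (PP : Set (RMat R X)) (P : RMat R X) : Set X :=
  {x | x ∈ subArms v P ∧ rewStar v P < rewMax v PP x P}

/-- The conic hull `𝒦 = cone(𝒫)`. -/
def coneP (PP : Set (RMat R X)) : Set (RMat R X) :=
  {Q | ∃ θ : ℝ, 0 ≤ θ ∧ ∃ Q' ∈ PP, Q = θ • Q'}

/-- The dual cone `𝒦*`. -/
def dualConeP (PP : Set (RMat R X)) : Set (RMat R X) :=
  {l | ∀ Q ∈ coneP PP, 0 ≤ ∑ x : X, ∑ r : R, l r x * Q r x}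

/-- Extended-real logarithm (with `elog t = ⊥` for `t ≤ 0`). -/
noncomputable def elog (t : ℝ) : EReal := if 0 < t then ((Real.log t : ℝ) : EReal) else ⊥

/-- The dual function `Dual(η, x', Q; μ)` for `μ = (α, β, λ)`. -/
noncomputable def dualFn (v : R → ℝ) (η : X → ℝ) (x' : X) (Q : RMat R X)
    (α β : ℝ) (l : RMat R X) : EReal :=
  if ∀ x ∈ subFinset v Q, ∀ r : R,
      0 ≤ η x - l r x - β - α * v r * (if x = x' then 1 else 0) then
    (∑ x ∈ subFinset v Q, ∑ r : R,
      ((η x * Q r x : ℝ) : EReal) *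
        elog ((η x - l r x - β - α * v r * (if x = x' then 1 else 0)) / η x)) +
    ((-(∑ x ∈ optFinset v Q, ∑ r : R, l r x * Q r x) + α * rewStar v Q +
        β * ((subFinset v Q).card : ℝ) : ℝ) : EReal)
  else ⊥

/-- The set `𝒫'` of reward distributions satisfying Assumption 1. -/
def PPrime (v : R → ℝ) (PP : Set (RMat R X)) : Set (RMat R X) :=
  {P | P ∈ PP ∧ (∃ x₀ : X, optArms v P = {x₀}) ∧
    (∀ x : X, rewMax v PP x P ≠ rewStar v P) ∧ P ∈ relIntIn POmega PP}

/-- The dual-test function `Dualbar(η, x', Q; μ) = max_{ρ ≥ 0} Dual(η, x', Q; ρ·μ)`. -/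
noncomputable def dualTest (v : R → ℝ) (η : X → ℝ) (x' : X) (Q : RMat R X)
    (μ : ℝ × ℝ × RMat R X) : EReal :=
  sSup {d : EReal | ∃ ρ : ℝ, 0 ≤ ρ ∧ d = dualFn v η x' Q (ρ * μ.1) (ρ * μ.2.1) (ρ • μ.2.2)}

end Core

end Bandit

namespace Bandit

/-- The half-space `H(x', P; μ)` of (nonnegative) reward matrices containing all deceitful
distributions associated with the dual variable `μ = (α, β, λ)`. -/
def Hset {R X : Type*} [Fintype R] [Fintype X] [Nonempty X]
    (v : R → ℝ) (x' : X) (P : RMat R X) (α β : ℝ) (l : RMat R X) : Set (RMat R X) :=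
  {Q | (∀ r x, 0 ≤ Q r x) ∧ (∀ x ∈ optArms v P, ∀ r, Q r x = P r x) ∧
    β * (Fintype.card X : ℝ) + α * rewStar v P ≤
      ∑ x : X, ∑ r : R, Q r x * (l r x + β + α * v r * (if x = x' then 1 else 0))}

section KKT

variable {ι : Type*} (s : Finset ι) (p η c : ι → ℝ) (b : ℝ)

/-- The dual optimality curve: the constraint value of the minimizer of the Lagrangian. -/
noncomputable def kktCurve (ρ : ℝ) : ℝ := ∑ i ∈ s, η i * p i / (η i - ρ * c i) * c i

/-- The Karush-Kuhn-Tucker conditions for minimizing `∑ η (p log (p / q) - p + q)` over `q ≥ 0`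
with `b ≤ ∑ q c`. -/
structure IsKKT (ρ : ℝ) (q : ι → ℝ) : Prop where
  multiplier_nonneg : 0 ≤ ρ
  nonneg : ∀ i ∈ s, 0 ≤ q i
  dual_feasible : ∀ i ∈ s, ρ * c i ≤ η i
  stationary : ∀ i ∈ s, q i * (η i - ρ * c i) = η i * p i
  feasible : b ≤ ∑ i ∈ s, q i * c i
  slackness : ρ * (∑ i ∈ s, q i * c i - b) = 0

variable {s p η c b}

theorem sub_mul_pos_of_le {e a ρ ρ₁ : ℝ} (he : 0 < e) (h0 : 0 ≤ ρ) (hρ : ρ ≤ ρ₁)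
    (h : ρ₁ * a < e) : 0 < e - ρ * a := by
  rcases le_total a 0 with ha | ha
  · nlinarith [mul_nonneg h0 (neg_nonneg.2 ha)]
  · nlinarith [mul_le_mul_of_nonneg_right hρ ha]

/-- A dual feasible point at which the curve has reached level `b` yields a KKT pair. -/
theorem exists_isKKT_of_le_kktCurve (hp : ∀ i ∈ s, 0 ≤ p i) (hη : ∀ i ∈ s, 0 < η i)
    (hb : ∑ i ∈ s, p i * c i ≤ b) {ρ₁ : ℝ} (hρ₁ : 0 ≤ ρ₁)
    (hle : ∀ i ∈ s, ρ₁ * c i ≤ η i) (hlt : ∀ i ∈ s, p i ≠ 0 → ρ₁ * c i < η i)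
    (hg : b ≤ kktCurve s p η c ρ₁) :
    ∃ ρ q, IsKKT s p η c b ρ q := by
  have hcont : ContinuousOn (kktCurve s p η c) (Set.Icc 0 ρ₁) := by
    refine continuousOn_finsetSum _ fun i hi => ?_
    by_cases hpi : p i = 0
    · simpa [hpi] using continuousOn_const
    · refine ContinuousOn.mul (ContinuousOn.div (by fun_prop) (by fun_prop) fun ρ hρ => ?_)
        (by fun_prop)
      exact (sub_mul_pos_of_le (hη i hi) hρ.1 hρ.2 (hlt i hi hpi)).ne'
  have h0 : kktCurve s p η c 0 = ∑ i ∈ s, p i * c i := by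
    refine Finset.sum_congr rfl fun i hi => ?_
    have := (hη i hi).ne'
    simp only [zero_mul, sub_zero]
    rw [mul_div_cancel_left₀ _ this]
  obtain ⟨ρ, hρ, hρb⟩ := intermediate_value_Icc hρ₁ hcont ⟨h0.trans_le hb, hg⟩
  have hsum : ∑ i ∈ s, η i * p i / (η i - ρ * c i) * c i = b := hρb
  have hdual : ∀ i ∈ s, ρ * c i ≤ η i := fun i hi => by
    rcases le_total (c i) 0 with hc | hc
    · nlinarith [hη i hi, mul_nonneg hρ.1 (neg_nonneg.2 hc)]
    · exact (mul_le_mul_of_nonneg_right hρ.2 hc).trans (hle i hi)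
  refine ⟨ρ, fun i => η i * p i / (η i - ρ * c i), hρ.1, fun i hi => ?_, hdual, fun i hi => ?_,
    hsum.ge, by rw [hsum]; ring⟩
  · exact div_nonneg (mul_nonneg (hη i hi).le (hp i hi)) (sub_nonneg.2 (hdual i hi))
  · by_cases hpi : p i = 0
    · simp [hpi]
    · exact div_mul_cancel₀ _
        (sub_mul_pos_of_le (hη i hi) hρ.1 hρ.2 (hlt i hi hpi)).ne'

theorem exists_isKKT_of_nonpos (hp : ∀ i ∈ s, 0 ≤ p i) (hη : ∀ i ∈ s, 0 < η i)
    {q₀ : ι → ℝ} (hq₀ : ∀ i ∈ s, 0 ≤ q₀ i) (hpq : ∀ i ∈ s, p i ≠ 0 → q₀ i ≠ 0)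
    (hfeas : b ≤ ∑ i ∈ s, q₀ i * c i) (hb : ∑ i ∈ s, p i * c i < b)
    (hc : ∀ i ∈ s, c i ≤ 0) : ∃ ρ q, IsKKT s p η c b ρ q := by
  have hterm : ∀ i ∈ s, q₀ i * c i ≤ 0 := fun i hi =>
    mul_nonpos_of_nonneg_of_nonpos (hq₀ i hi) (hc i hi)
  have hb0 : b < 0 := by
    by_contra! hb0
    have hzero := (Finset.sum_eq_zero_iff_of_nonpos hterm).1
      (le_antisymm (Finset.sum_nonpos hterm) (hb0.trans hfeas))
    have : ∑ i ∈ s, p i * c i = 0 := Finset.sum_eq_zero fun i hi => by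
      by_cases hpi : p i = 0
      · simp [hpi]
      · simp [(mul_eq_zero.1 (hzero i hi)).resolve_left (hpq i hi hpi)]
    linarith [Finset.sum_nonpos hterm]
  have hlim : Tendsto (kktCurve s p η c) atTop (nhds 0) := by
    rw [← Finset.sum_const_zero (s := s)]
    refine tendsto_finsetSum _ fun i hi => ?_
    rcases (hc i hi).eq_or_lt with h | h
    · simp [h]
    · have h1 : Tendsto (fun ρ : ℝ => η i - ρ * c i) atTop atTop := by
        simp only [sub_eq_add_neg, ← mul_neg]
        exact tendsto_atTop_add_const_left _ _
          (tendsto_id.atTop_mul_const (neg_pos.2 h))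
      simpa using (h1.const_div_atTop (η i * p i)).mul_const (c i)
  obtain ⟨ρ₁, hg, hρ₁⟩ := ((hlim.eventually (lt_mem_nhds hb0)).and (eventually_ge_atTop 0)).exists
  have hlt : ∀ i ∈ s, ρ₁ * c i < η i := fun i hi =>
    (mul_nonpos_of_nonneg_of_nonpos hρ₁ (hc i hi)).trans_lt (hη i hi)
  exact exists_isKKT_of_le_kktCurve hp hη hb.le hρ₁ (fun i hi => (hlt i hi).le)
    (fun i hi _ => hlt i hi) hg.le

theorem exists_isKKT_of_singular (hp : ∀ i ∈ s, 0 ≤ p i) (hη : ∀ i ∈ s, 0 < η i)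
    (hb : ∑ i ∈ s, p i * c i < b) {ρm : ℝ} (hρm : 0 < ρm)
    (hle : ∀ i ∈ s, ρm * c i ≤ η i) {j : ι} (hj : j ∈ s) (hpj : 0 < p j)
    (hjm : ρm * c j = η j) : ∃ ρ q, IsKKT s p η c b ρ q := by
  have hηj := hη j hj
  have hcj : 0 < c j := by
    by_contra! h
    nlinarith [mul_nonneg hρm.le (neg_nonneg.2 h)]
  have hpc : 0 < p j * c j := mul_pos hpj hcj
  set K := b - ∑ i ∈ s, p i * c i with hK
  have hK0 : 0 < K := sub_pos.2 hb
  set θ := K / (K + p j * c j) with hθ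
  have hθ0 : 0 < θ := by positivity
  have hθ1 : θ < 1 := (div_lt_one (by positivity)).2 (by linarith)
  have hlt : ∀ i ∈ s, θ * ρm * c i < η i := fun i hi => by
    have := hη i hi
    nlinarith [mul_le_mul_of_nonneg_left (hle i hi) hθ0.le]
  have hρ0 : 0 ≤ θ * ρm := by positivity
  refine exists_isKKT_of_le_kktCurve hp hη hb.le hρ0 (fun i hi => (hlt i hi).le)
    (fun i hi _ => hlt i hi) ?_
  have hterm : ∀ i ∈ s, p i * c i ≤ η i * p i / (η i - θ * ρm * c i) * c i := fun i hi => by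
    have hd : 0 < η i - θ * ρm * c i := sub_pos.2 (hlt i hi)
    rw [div_mul_eq_mul_div, le_div_iff₀ hd]
    nlinarith [mul_nonneg (mul_nonneg (hp i hi) hρ0) (mul_self_nonneg (c i))]
  have hjterm : η j * p j / (η j - θ * ρm * c j) * c j = K + p j * c j := by
    have h1 : η j - θ * ρm * c j = η j * (p j * c j / (K + p j * c j)) := by
      rw [mul_assoc, hjm, hθ]
      field_simp
      ring
    rw [h1]
    field_simp
  have := Finset.sum_le_sum fun i (hi : i ∈ s.erase j) => hterm i (Finset.mem_of_mem_erase hi)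
  rw [kktCurve, ← Finset.add_sum_erase _ _ hj, hjterm]
  rw [← Finset.add_sum_erase _ _ hj] at hK
  linarith

/-- Existence of a KKT pair, under feasibility at a point whose support contains that of `p`. -/
theorem exists_isKKT (hp : ∀ i ∈ s, 0 ≤ p i) (hη : ∀ i ∈ s, 0 < η i)
    {q₀ : ι → ℝ} (hq₀ : ∀ i ∈ s, 0 ≤ q₀ i) (hpq : ∀ i ∈ s, p i ≠ 0 → q₀ i ≠ 0)
    (hfeas : b ≤ ∑ i ∈ s, q₀ i * c i) : ∃ ρ q, IsKKT s p η c b ρ q := by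
  rcases le_or_gt b (∑ i ∈ s, p i * c i) with hb | hb
  · exact ⟨0, p, le_rfl, hp, fun i hi => by simpa using (hη i hi).le, fun i _ => by ring, hb,
      by simp⟩
  by_cases hc : ∀ i ∈ s, c i ≤ 0
  · exact exists_isKKT_of_nonpos hp hη hq₀ hpq hfeas hb hc
  push Not at hc
  obtain ⟨i₁, hi₁, hci₁⟩ := hc
  obtain ⟨k, hk, hkmin⟩ := Finset.exists_min_image (s.filter fun i => 0 < c i)
    (fun i => η i / c i) ⟨i₁, Finset.mem_filter.2 ⟨hi₁, hci₁⟩⟩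
  obtain ⟨hks, hck⟩ := Finset.mem_filter.1 hk
  set ρm := η k / c k with hρm_def
  have hρm : 0 < ρm := div_pos (hη k hks) hck
  have hkm : ρm * c k = η k := div_mul_cancel₀ _ hck.ne'
  have hle : ∀ i ∈ s, ρm * c i ≤ η i := fun i hi => by
    rcases le_or_gt (c i) 0 with h | h
    · exact (mul_nonpos_of_nonneg_of_nonpos hρm.le h).trans (hη i hi).le
    · exact (le_div_iff₀ h).1 (hkmin i (Finset.mem_filter.2 ⟨hi, h⟩))
  by_cases hsing : ∃ j ∈ s, p j ≠ 0 ∧ ρm * c j = η j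
  · obtain ⟨j, hj, hpj, hjm⟩ := hsing
    exact exists_isKKT_of_singular hp hη hb hρm hle hj ((hp j hj).lt_of_ne' hpj) hjm
  push Not at hsing
  have hlt : ∀ i ∈ s, p i ≠ 0 → ρm * c i < η i := fun i hi h => (hle i hi).lt_of_ne (hsing i hi h)
  rcases le_or_gt b (kktCurve s p η c ρm) with hg | hg
  · exact exists_isKKT_of_le_kktCurve hp hη hb.le hρm.le hle hlt hg
  have hδ : 0 < (b - kktCurve s p η c ρm) / c k := div_pos (sub_pos.2 hg) hck
  have hsum : ∑ i ∈ s, (η i * p i / (η i - ρm * c i) +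
      if i = k then (b - kktCurve s p η c ρm) / c k else 0) * c i = b := by
    simp only [add_mul, Finset.sum_add_distrib, ite_mul, zero_mul, Finset.sum_ite_eq', hks,
      if_true]
    rw [div_mul_cancel₀ _ hck.ne', ← kktCurve]
    ring
  refine ⟨ρm, _, hρm.le, fun i hi => ?_, hle, fun i hi => ?_, hsum.ge, by rw [hsum]; ring⟩
  · have := div_nonneg (mul_nonneg (hη i hi).le (hp i hi)) (sub_nonneg.2 (hle i hi))
    split_ifs <;> linarith
  · have h1 : η i * p i / (η i - ρm * c i) * (η i - ρm * c i) = η i * p i := by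
      by_cases hpi : p i = 0
      · simp [hpi]
      · exact div_mul_cancel₀ _ (sub_pos.2 (hlt i hi hpi)).ne'
    rw [add_mul, h1]
    split_ifs with h
    · rw [h, hkm]; ring
    · ring

end KKT

section Pointwise

/-- Fenchel-Young inequality for the information distance. -/
theorem mul_elog_le {e p q d : ℝ} (he : 0 < e) (hp : 0 ≤ p) (hq : 0 ≤ q) (hqp : q = 0 → p = 0)
    (hd : d ≤ e) :
    ((e * p : ℝ) : EReal) * elog ((e - d) / e) ≤
      ((e * (p * Real.log (p / q) - p + q) - d * q : ℝ) : EReal) := by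
  rcases hp.eq_or_lt with rfl | hp
  · simp only [mul_zero, EReal.coe_zero, zero_mul]
    rw [← EReal.coe_zero, EReal.coe_le_coe_iff]
    nlinarith [mul_nonneg (sub_nonneg.2 hd) hq]
  have hq : 0 < q := hq.lt_of_ne' fun h => hp.ne' (hqp h)
  unfold elog
  split_ifs with ht
  · rw [← EReal.coe_mul, EReal.coe_le_coe_iff]
    set t := (e - d) / e with ht_def
    have hde : d = e * (1 - t) := by rw [ht_def]; field_simp; ring
    have hlog := Real.log_le_sub_one_of_pos (show 0 < t * (q / p) by positivity)
    rw [Real.log_mul ht.ne' (by positivity), ← inv_div, Real.log_inv] at hlog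
    have h1 := mul_le_mul_of_nonneg_left hlog (mul_pos he hp).le
    have h2 : e * p * (t * (p / q)⁻¹ - 1) = e * (t * q - p) := by field_simp
    rw [h2] at h1
    rw [hde]
    linarith
  · rw [EReal.coe_mul_bot_of_pos (mul_pos he hp)]
    exact bot_le

theorem mul_elog_eq {e p q d : ℝ} (he : 0 < e) (hp : 0 ≤ p) (hq : 0 ≤ q)
    (h : q * (e - d) = e * p) :
    ((e * p : ℝ) : EReal) * elog ((e - d) / e) =
      ((e * (p * Real.log (p / q) - p + q) - d * q : ℝ) : EReal) := by
  rcases hp.eq_or_lt with rfl | hp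
  · simp only [mul_zero, EReal.coe_zero, zero_mul]
    rw [← EReal.coe_zero, EReal.coe_eq_coe_iff]
    linarith
  have hep := mul_pos he hp
  have hq : 0 < q := hq.lt_of_ne' fun h0 => by simp [h0] at h; grind
  have ht : (e - d) / e = p / q := by
    rw [div_eq_div_iff he.ne' hq.ne']; linarith
  rw [ht, elog, if_pos (div_pos hp hq), ← EReal.coe_mul]
  congr 1
  linarith

theorem ereal_coe_sum {ι : Type*} (s : Finset ι) (f : ι → ℝ) :
    ((∑ i ∈ s, f i : ℝ) : EReal) = ∑ i ∈ s, (f i : EReal) :=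
  map_sum (⟨⟨Real.toEReal, EReal.coe_zero⟩, EReal.coe_add⟩ : ℝ →+ EReal) f s

variable {R : Type*} [Fintype R]

theorem sum_mul_elog_add_le {e : ℝ} {p q d : R → ℝ} (he : 0 < e) (hp : ∀ r, 0 ≤ p r)
    (hq : ∀ r, 0 ≤ q r) (hd : ∀ r, d r ≤ e) :
    ∑ r, ((e * p r : ℝ) : EReal) * elog ((e - d r) / e) + ((∑ r, d r * q r : ℝ) : EReal) ≤
      (e : EReal) * infoDiv p q := by
  unfold infoDiv
  split_ifs with h
  · calc _ ≤ ∑ r, ((e * (p r * Real.log (p r / q r) - p r + q r) - d r * q r : ℝ) : EReal) +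
          ((∑ r, d r * q r : ℝ) : EReal) :=
          add_le_add_left (Finset.sum_le_sum fun r _ =>
            mul_elog_le he (hp r) (hq r) (h r) (hd r)) _
      _ = _ := by
          rw [← ereal_coe_sum, ← EReal.coe_add, ← EReal.coe_mul, Finset.mul_sum,
            ← Finset.sum_add_distrib]
          simp
  · rw [EReal.coe_mul_top_of_pos he]
    exact le_top

theorem sum_mul_elog_add_eq {e : ℝ} {p q d : R → ℝ} (he : 0 < e) (hp : ∀ r, 0 ≤ p r)
    (hq : ∀ r, 0 ≤ q r) (hst : ∀ r, q r * (e - d r) = e * p r) :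
    ∑ r, ((e * p r : ℝ) : EReal) * elog ((e - d r) / e) + ((∑ r, d r * q r : ℝ) : EReal) =
      (e : EReal) * infoDiv p q := by
  have h : ∀ r, q r = 0 → p r = 0 := fun r hr => by
    have := hst r
    rw [hr, zero_mul] at this
    exact (mul_eq_zero.1 this.symm).resolve_left he.ne'
  rw [infoDiv, if_pos h, Finset.sum_congr rfl fun r _ =>
      mul_elog_eq he (hp r) (hq r) (hst r), ← ereal_coe_sum, ← EReal.coe_add,
    ← EReal.coe_mul, Finset.mul_sum, ← Finset.sum_add_distrib]
  simp

end Pointwise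

section Duality

variable {R X : Type*} [Fintype R] [Fintype X] [Nonempty X]

/-- The coefficients of the half-space constraint. -/
noncomputable def hcoef (v : R → ℝ) (x' : X) (α β : ℝ) (l : RMat R X) (x : X) (r : R) : ℝ :=
  l r x + β + α * v r * (if x = x' then 1 else 0)

/-- The level of the half-space constraint restricted to the suboptimal arms. -/
noncomputable def hlevel (v : R → ℝ) (P : RMat R X) (α β : ℝ) (l : RMat R X) : ℝ :=
  -(∑ x ∈ optFinset v P, ∑ r : R, l r x * P r x) + α * rewStar v P +
    β * ((subFinset v P).card : ℝ)

theorem mem_Hset_iff {v : R → ℝ} {P Q : RMat R X} (hP : P ∈ POmega) {x' : X}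
    (hx' : x' ∈ subArms v P) {α β : ℝ} {l : RMat R X} :
    Q ∈ Hset v x' P α β l ↔ (∀ r x, 0 ≤ Q r x) ∧ (∀ x ∈ optArms v P, ∀ r, Q r x = P r x) ∧
      hlevel v P α β l ≤ ∑ x ∈ subFinset v P, ∑ r, Q r x * hcoef v x' α β l x r := by
  refine and_congr_right fun _ => and_congr_right fun hQ => ?_
  have hopt : ∑ x ∈ optFinset v P, ∑ r, Q r x * hcoef v x' α β l x r =
      ∑ x ∈ optFinset v P, ∑ r, l r x * P r x + (optFinset v P).card * β := by
    rw [← nsmul_eq_mul, ← Finset.sum_const, ← Finset.sum_add_distrib]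
    refine Finset.sum_congr rfl fun x hx => ?_
    have hx : x ∈ optArms v P := (Finset.mem_filter.1 hx).2
    have hne : x ≠ x' := fun h => hx' (h ▸ hx)
    have h1 : β = ∑ r, P r x * β := by rw [← Finset.sum_mul, hP.2 x, one_mul]
    conv_rhs => rw [h1]
    rw [← Finset.sum_add_distrib]
    refine Finset.sum_congr rfl fun r _ => ?_
    simp only [hcoef, hne, if_false, hQ x hx r]
    ring
  have hsplit : ∑ x, ∑ r, Q r x * hcoef v x' α β l x r =
      ∑ x ∈ optFinset v P, ∑ r, Q r x * hcoef v x' α β l x r +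
        ∑ x ∈ subFinset v P, ∑ r, Q r x * hcoef v x' α β l x r :=
    (Finset.sum_filter_add_sum_filter_not _ _ _).symm
  have hcard : (Fintype.card X : ℝ) = (optFinset v P).card + (subFinset v P).card := by
    rw [← Finset.card_univ]
    exact_mod_cast (Finset.card_filter_add_card_filter_not _).symm
  change β * (Fintype.card X : ℝ) + α * rewStar v P ≤
    ∑ x, ∑ r, Q r x * hcoef v x' α β l x r ↔ _
  rw [hsplit, hopt, hcard, hlevel]
  constructor <;> intro h <;> linarith

theorem dualFn_smul (v : R → ℝ) (η : X → ℝ) (x' : X) (P : RMat R X) (α β : ℝ) (l : RMat R X)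
    (ρ : ℝ) :
    dualFn v η x' P (ρ * α) (ρ * β) (ρ • l) =
      if ∀ x ∈ subFinset v P, ∀ r : R, ρ * hcoef v x' α β l x r ≤ η x then
        ∑ x ∈ subFinset v P, ∑ r : R,
          ((η x * P r x : ℝ) : EReal) * elog ((η x - ρ * hcoef v x' α β l x r) / η x) +
        ((ρ * hlevel v P α β l : ℝ) : EReal)
      else ⊥ := by
  have hc : ∀ x r, η x - (ρ • l) r x - ρ * β - ρ * α * v r * (if x = x' then 1 else 0) =
      η x - ρ * hcoef v x' α β l x r := fun x r => by
    simp only [Pi.smul_apply, smul_eq_mul, hcoef]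
    ring
  have hb : -(∑ x ∈ optFinset v P, ∑ r : R, (ρ • l) r x * P r x) + ρ * α * rewStar v P +
      ρ * β * ((subFinset v P).card : ℝ) = ρ * hlevel v P α β l := by
    simp only [Pi.smul_apply, smul_eq_mul, hlevel, mul_assoc, ← Finset.mul_sum]
    ring
  simp only [dualFn, hc, hb, sub_nonneg]

theorem dualFn_le_distObj {v : R → ℝ} {η : X → ℝ} (hη : ∀ x, 0 < η x) {x' : X}
    {P Q : RMat R X} (hP : ∀ r x, 0 ≤ P r x) (hQ : ∀ r x, 0 ≤ Q r x) {α β : ℝ} {l : RMat R X}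
    (hlev : hlevel v P α β l ≤ ∑ x ∈ subFinset v P, ∑ r, Q r x * hcoef v x' α β l x r)
    {ρ : ℝ} (hρ : 0 ≤ ρ) :
    dualFn v η x' P (ρ * α) (ρ * β) (ρ • l) ≤ distObj v η P Q := by
  rw [dualFn_smul]
  split_ifs with hd
  swap
  · exact bot_le
  have hlev' : ρ * hlevel v P α β l ≤
      ∑ x ∈ subFinset v P, ∑ r, ρ * hcoef v x' α β l x r * Q r x := by
    refine (mul_le_mul_of_nonneg_left hlev hρ).trans_eq ?_
    simp only [Finset.mul_sum]
    exact Finset.sum_congr rfl fun x _ => Finset.sum_congr rfl fun r _ => by ring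
  refine (add_le_add_right (EReal.coe_le_coe_iff.2 hlev') _).trans ?_
  rw [ereal_coe_sum, ← Finset.sum_add_distrib]
  exact Finset.sum_le_sum fun x hx =>
    sum_mul_elog_add_le (hη x) (fun r => hP r x) (fun r => hQ r x) (hd x hx)

theorem dualFn_eq_distObj {v : R → ℝ} {η : X → ℝ} (hη : ∀ x, 0 < η x) {x' : X}
    {P Q : RMat R X} (hP : ∀ r x, 0 ≤ P r x) {α β : ℝ} {l : RMat R X} {ρ : ℝ}
    (h : IsKKT (subFinset v P ×ˢ (Finset.univ : Finset R)) (fun i => P i.2 i.1) (fun i => η i.1)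
      (fun i => hcoef v x' α β l i.1 i.2) (hlevel v P α β l) ρ (fun i => Q i.2 i.1)) :
    dualFn v η x' P (ρ * α) (ρ * β) (ρ • l) = distObj v η P Q := by
  have hmem : ∀ x ∈ subFinset v P, ∀ r : R, (x, r) ∈ subFinset v P ×ˢ Finset.univ :=
    fun x hx r => Finset.mk_mem_product hx (Finset.mem_univ r)
  have hd : ∀ x ∈ subFinset v P, ∀ r : R, ρ * hcoef v x' α β l x r ≤ η x :=
    fun x hx r => h.dual_feasible _ (hmem x hx r)
  have hlev : ρ * hlevel v P α β l =
      ∑ x ∈ subFinset v P, ∑ r, ρ * hcoef v x' α β l x r * Q r x := by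
    have hs := h.slackness
    rw [mul_sub, sub_eq_zero, Finset.sum_product, Finset.mul_sum] at hs
    rw [← hs]
    simp only [Finset.mul_sum]
    exact Finset.sum_congr rfl fun x _ => Finset.sum_congr rfl fun r _ => by ring
  rw [dualFn_smul, if_pos hd, hlev, ereal_coe_sum, ← Finset.sum_add_distrib]
  exact Finset.sum_congr rfl fun x hx =>
    sum_mul_elog_add_eq (hη x) (fun r => hP r x) (fun r => h.nonneg _ (hmem x hx r))
      fun r => h.stationary _ (hmem x hx r)

/-- A deceitful arm makes the half-space contain a point whose support contains that of `P`. -/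
theorem exists_mem_Hset {v : R → ℝ} {PP : Set (RMat R X)} (hsub : PP ⊆ POmega)
    (hconv : Convex ℝ PP) {P : RMat R X} (hP : P ∈ PP) {x' : X} (hx' : x' ∈ deceitArms v PP P)
    {α β : ℝ} {l : RMat R X} (hl : l ∈ dualConeP PP) :
    ∃ Q ∈ Hset v x' P α β l, ∀ r x, P r x ≠ 0 → Q r x ≠ 0 := by
  have hlt := hx'.2
  rw [rewMax] at hlt
  obtain ⟨_, ⟨Q, hQ, hQopt, rfl⟩, hlt⟩ :=
    exists_lt_of_lt_csSup (by exact ⟨_, P, hP, fun _ _ _ => rfl, rfl⟩) hlt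
  have hA : rewOf v P x' ≤ rewStar v P := Finset.le_sup' _ (Finset.mem_univ x')
  have hBA : 0 < rewOf v Q x' - rewOf v P x' := by linarith
  set t := (rewStar v P - rewOf v P x') / (rewOf v Q x' - rewOf v P x') with ht
  have ht0 : 0 ≤ t := div_nonneg (by linarith) hBA.le
  have ht1 : t < 1 := (div_lt_one hBA).2 (by linarith)
  have htv : t * (rewOf v Q x' - rewOf v P x') = rewStar v P - rewOf v P x' :=
    div_mul_cancel₀ _ hBA.ne'
  have hmem : (1 - t) • P + t • Q ∈ PP := hconv hP hQ (by linarith) ht0 (by ring)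
  have hval : ∀ r x, ((1 - t) • P + t • Q) r x = (1 - t) * P r x + t * Q r x := fun _ _ => rfl
  have hrew : ∑ r, v r * ((1 - t) • P + t • Q) r x' = rewStar v P := by
    have : ∑ r, v r * ((1 - t) • P + t • Q) r x' = (1 - t) * rewOf v P x' + t * rewOf v Q x' := by
      simp only [hval, rewOf, Finset.mul_sum, ← Finset.sum_add_distrib]
      exact Finset.sum_congr rfl fun r _ => by ring
    linarith
  refine ⟨(1 - t) • P + t • Q, ⟨(hsub hmem).1, fun x hx r => ?_, ?_⟩, fun r x hPr => ?_⟩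
  · rw [hval, hQopt x hx r]; ring
  · have hdual := hl _ ⟨1, zero_le_one, _, hmem, (one_smul _ _).symm⟩
    have hone := (hsub hmem).2
    generalize (1 - t) • P + t • Q = W at hdual hone hrew
    have hcol : ∀ x, ∑ r, W r x * (l r x + β + α * v r * (if x = x' then 1 else 0)) =
        ∑ r, l r x * W r x + β + if x = x' then α * ∑ r, v r * W r x else 0 := fun x => by
      have h1 : β = ∑ r, W r x * β := by rw [← Finset.sum_mul, hone x, one_mul]
      conv_rhs => rw [h1]
      split_ifs
      · simp only [Finset.mul_sum, ← Finset.sum_add_distrib]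
        exact Finset.sum_congr rfl fun r _ => by ring
      · simp only [add_zero, ← Finset.sum_add_distrib]
        exact Finset.sum_congr rfl fun r _ => by ring
    simp only [hcol, Finset.sum_add_distrib, Finset.sum_ite_eq', Finset.mem_univ, if_true, hrew,
      Finset.sum_const, Finset.card_univ, nsmul_eq_mul]
    linarith
  · have hPr : 0 < P r x := ((hsub hP).1 r x).lt_of_ne' hPr
    have hQr := (hsub hQ).1 r x
    rw [hval]
    have : 0 < 1 - t := by linarith
    positivity

end Duality

/-- dual-test function as an information projection:
for `P ∈ int(𝒫)`, `η > 0`, a deceitful arm `x' ∈ X̃_d(P)` and a dual feasible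
`μ = (α, β, λ) ∈ ℝ₊ × ℝ × 𝒦*`, the value `max_{ρ ≥ 0} Dual(η, x', P; ρ·μ)` is the
(attained) minimum of `Σ_{x∈X̃(P)} η(x)·I(P(x),Q(x))` over `Q ∈ H(x', P; μ)`. -/
theorem dual_test_projection
    {R X : Type*} [Fintype R] [Fintype X] [Nonempty X]
    (v : R → ℝ) (hv : ∀ r, 0 ≤ v r)
    (PP : Set (RMat R X)) (hsub : PP ⊆ POmega) (hconv : Convex ℝ PP)
    (hcomp : IsCompact PP) (hne : (relIntIn POmega PP).Nonempty)
    (P : RMat R X) (hP : P ∈ relIntIn POmega PP)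
    (η : X → ℝ) (hη : ∀ x, 0 < η x)
    (x' : X) (hx' : x' ∈ deceitArms v PP P)
    (α β : ℝ) (l : RMat R X) (hα : 0 ≤ α) (hl : l ∈ dualConeP PP) :
    IsLeast {c : EReal | ∃ Q ∈ Hset v x' P α β l, c = distObj v η P Q}
      (sSup {d : EReal | ∃ ρ : ℝ, 0 ≤ ρ ∧
        d = dualFn v η x' P (ρ * α) (ρ * β) (ρ • l)}) := by
  have hPP := hP.1
  have hPΩ := hsub hPP
  obtain ⟨Q₀, hQ₀, hsupp⟩ := exists_mem_Hset (β := β) hsub hconv hPP hx' hl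
  have hQ₀' := (mem_Hset_iff hPΩ hx'.1).1 hQ₀
  obtain ⟨ρ, q, hk⟩ := exists_isKKT (s := subFinset v P ×ˢ (Finset.univ : Finset R))
    (p := fun i => P i.2 i.1) (η := fun i => η i.1)
    (c := fun i => hcoef v x' α β l i.1 i.2) (b := hlevel v P α β l) (q₀ := fun i => Q₀ i.2 i.1)
    (fun i _ => hPΩ.1 _ _) (fun i _ => hη _) (fun i _ => hQ₀'.1 _ _) (fun i _ => hsupp _ _)
    (by rw [Finset.sum_product]; exact hQ₀'.2.2)
  set Q : RMat R X := fun r x => if x ∈ subFinset v P then q (x, r) else P r x with hQdef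
  have hQq : ∀ i ∈ subFinset v P ×ˢ (Finset.univ : Finset R), Q i.2 i.1 = q i := fun i hi =>
    if_pos (Finset.mem_product.1 hi).1
  have hk' : IsKKT (subFinset v P ×ˢ (Finset.univ : Finset R)) (fun i => P i.2 i.1)
      (fun i => η i.1) (fun i => hcoef v x' α β l i.1 i.2) (hlevel v P α β l) ρ
      (fun i => Q i.2 i.1) := by
    have hsum : ∑ i ∈ subFinset v P ×ˢ (Finset.univ : Finset R),
        Q i.2 i.1 * hcoef v x' α β l i.1 i.2 =
        ∑ i ∈ subFinset v P ×ˢ (Finset.univ : Finset R), q i * hcoef v x' α β l i.1 i.2 :=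
      Finset.sum_congr rfl fun i hi => by rw [hQq i hi]
    exact ⟨hk.multiplier_nonneg, fun i hi => (hk.nonneg i hi).trans_eq (hQq i hi).symm,
      hk.dual_feasible, fun i hi => (congrArg (· * _) (hQq i hi)).trans (hk.stationary i hi),
      hk.feasible.trans_eq hsum.symm, by rw [hsum]; exact hk.slackness⟩
  have hQH : Q ∈ Hset v x' P α β l := by
    refine (mem_Hset_iff hPΩ hx'.1).2 ⟨fun r x => ?_, fun x hx r => ?_, ?_⟩
    · by_cases hx : x ∈ subFinset v P
      · exact hk'.nonneg (x, r) (Finset.mk_mem_product hx (Finset.mem_univ r))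
      · simpa [hQdef, hx] using hPΩ.1 r x
    · exact if_neg fun h : x ∈ subFinset v P => (Finset.mem_filter.1 h).2 hx
    · have := hk'.feasible
      rwa [Finset.sum_product] at this
  have hweak : ∀ W ∈ Hset v x' P α β l, sSup {d : EReal | ∃ ρ : ℝ, 0 ≤ ρ ∧
      d = dualFn v η x' P (ρ * α) (ρ * β) (ρ • l)} ≤ distObj v η P W := by
    rintro W hW
    obtain ⟨hW0, -, hlev⟩ := (mem_Hset_iff hPΩ hx'.1).1 hW
    refine sSup_le ?_
    rintro _ ⟨ρ, hρ, rfl⟩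
    exact dualFn_le_distObj hη hPΩ.1 hW0 hlev hρ
  refine ⟨⟨Q, hQH, (hweak Q hQH).antisymm ?_⟩, ?_⟩
  · exact le_sSup ⟨ρ, hk.multiplier_nonneg, (dualFn_eq_distObj hη hPΩ.1 hk').symm⟩
  · rintro _ ⟨W, hW, rfl⟩
    exact hweak W hW

end Bandit
end

section
/- Continuity of the distance function: suppose the reward distribution P ∈ int(𝒫) has a unique optimal arm x*(P), and let x′ ∈ X̃_d(P) be a deceitful arm of P. Then the function (η,Q) ↦ Dist(η,x′,Q) is continuous at every point (η₀,P) with η₀ > 0 componentwise. -/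
open scoped BigOperators Classical
open Filter

namespace Bandit

/-- The integrand `a log (a / b) - a + b` of the information distance, in its dual form: a
supremum of functions that are linear in `(a, b)`. -/
noncomputable def klTerm (a b : ℝ) : ENNReal :=
  ⨆ y : ℝ, ENNReal.ofReal (a * y - b * (Real.exp y - 1))

lemma lowerSemicontinuous_klTerm :
    LowerSemicontinuous fun p : ℝ × ℝ => klTerm p.1 p.2 := by
  refine lowerSemicontinuous_iSup fun y => Continuous.lowerSemicontinuous ?_
  exact ENNReal.continuous_ofReal.comp (by fun_prop)

lemma klTerm_convex_right (a b b' : ℝ) {t : ℝ} (ht0 : 0 ≤ t) (ht1 : t ≤ 1) :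
    klTerm a ((1 - t) * b + t * b') ≤
      ENNReal.ofReal (1 - t) * klTerm a b + ENNReal.ofReal t * klTerm a b' := by
  refine iSup_le fun y => ?_
  have h : a * y - ((1 - t) * b + t * b') * (Real.exp y - 1) =
      (1 - t) * (a * y - b * (Real.exp y - 1)) + t * (a * y - b' * (Real.exp y - 1)) := by ring
  rw [h]
  refine ENNReal.ofReal_add_le.trans ?_
  rw [ENNReal.ofReal_mul (sub_nonneg.2 ht1), ENNReal.ofReal_mul ht0]
  gcongr
  · exact le_iSup (fun y : ℝ => ENNReal.ofReal (a * y - b * (Real.exp y - 1))) y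
  · exact le_iSup (fun y : ℝ => ENNReal.ofReal (a * y - b' * (Real.exp y - 1))) y

lemma klTerm_zero_left {b : ℝ} (hb : 0 ≤ b) : klTerm 0 b = ENNReal.ofReal b := by
  apply le_antisymm
  · refine iSup_le fun y => ENNReal.ofReal_le_ofReal ?_
    nlinarith [mul_nonneg hb (Real.exp_pos y).le]
  · have h : Tendsto (fun y : ℝ => ENNReal.ofReal (0 * y - b * (Real.exp y - 1))) atBot
        (nhds (ENNReal.ofReal b)) := by
      refine ENNReal.tendsto_ofReal ?_
      simpa using (Real.tendsto_exp_atBot.sub_const 1).const_mul (-b)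
    exact le_of_tendsto' h fun y =>
      le_iSup (fun y : ℝ => ENNReal.ofReal (0 * y - b * (Real.exp y - 1))) y

lemma klTerm_zero_right {a : ℝ} (ha : 0 < a) : klTerm a 0 = ⊤ := by
  have h : Tendsto (fun y : ℝ => ENNReal.ofReal (a * y - 0 * (Real.exp y - 1))) atTop
      (nhds ⊤) := by
    refine ENNReal.tendsto_ofReal_atTop.comp ?_
    simpa using tendsto_id.const_mul_atTop ha
  exact top_le_iff.1 (le_of_tendsto' h fun y =>
    le_iSup (fun y : ℝ => ENNReal.ofReal (a * y - 0 * (Real.exp y - 1))) y)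

lemma mul_sub_mul_exp_le {a b : ℝ} (ha : 0 < a) (hb : 0 < b) (y : ℝ) :
    a * y - b * (Real.exp y - 1) ≤ a * Real.log (a / b) - a + b := by
  have h1 := Real.add_one_le_exp (y - Real.log (a / b))
  rw [Real.exp_sub, Real.exp_log (div_pos ha hb)] at h1
  have h2 := mul_le_mul_of_nonneg_left h1 ha.le
  have h3 : a * (Real.exp y / (a / b)) = b * Real.exp y := by field_simp
  rw [h3] at h2
  linarith

lemma klTerm_of_pos_right {a b : ℝ} (ha : 0 ≤ a) (hb : 0 < b) :
    klTerm a b = ENNReal.ofReal (a * Real.log (a / b) - a + b) := by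
  rcases ha.eq_or_lt with rfl | ha
  · simp [klTerm_zero_left hb.le]
  apply le_antisymm
  · exact iSup_le fun y => ENNReal.ofReal_le_ofReal (mul_sub_mul_exp_le ha hb y)
  · refine le_iSup_of_le (Real.log (a / b)) (ENNReal.ofReal_le_ofReal (le_of_eq ?_))
    rw [Real.exp_log (div_pos ha hb)]
    field_simp
    ring

lemma klTerm_of_imp {a b : ℝ} (ha : 0 ≤ a) (hb : 0 ≤ b) (h : b = 0 → a = 0) :
    klTerm a b = ENNReal.ofReal (a * Real.log (a / b) - a + b) := by
  rcases hb.eq_or_lt with rfl | hb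
  · simp [h rfl, klTerm_zero_left]
  · exact klTerm_of_pos_right ha hb

lemma log_div_term_nonneg {a b : ℝ} (ha : 0 ≤ a) (hb : 0 ≤ b) (h : b = 0 → a = 0) :
    0 ≤ a * Real.log (a / b) - a + b := by
  rcases ha.eq_or_lt with rfl | ha
  · simpa using hb
  · have hb' : 0 < b := hb.lt_of_ne fun hb0 => ha.ne' (h hb0.symm)
    simpa using mul_sub_mul_exp_le ha hb' 0

lemma klTerm_ne_top {a b : ℝ} (ha : 0 ≤ a) (hb : 0 < b) : klTerm a b ≠ ⊤ := by
  simp [klTerm_of_pos_right ha hb]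

lemma continuousOn_klTerm :
    ContinuousOn (fun p : ℝ × ℝ => klTerm p.1 p.2) {p | 0 ≤ p.1 ∧ 0 < p.2} := by
  have h : ContinuousOn
      (fun p : ℝ × ℝ => ENNReal.ofReal (p.1 * Real.log p.1 - p.1 * Real.log p.2 - p.1 + p.2))
      {p | 0 ≤ p.1 ∧ 0 < p.2} := by
    refine ENNReal.continuous_ofReal.comp_continuousOn ?_
    have h1 : ContinuousOn (fun p : ℝ × ℝ => p.1 * Real.log p.1) {p | 0 ≤ p.1 ∧ 0 < p.2} :=
      (Real.continuous_mul_log.comp continuous_fst).continuousOn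
    have h2 : ContinuousOn (fun p : ℝ × ℝ => Real.log p.2) {p | 0 ≤ p.1 ∧ 0 < p.2} :=
      continuousOn_snd.log fun p hp => hp.2.ne'
    exact ((h1.sub (continuousOn_fst.mul h2)).sub continuousOn_fst).add continuousOn_snd
  refine h.congr fun p hp => ?_
  dsimp only
  rw [klTerm_of_pos_right hp.1 hp.2]
  rcases hp.1.eq_or_lt with h0 | h0
  · simp [← h0]
  · rw [Real.log_div h0.ne' hp.2.ne', mul_sub]

lemma coe_ennreal_sum {ι : Type*} (s : Finset ι) (f : ι → ENNReal) :
    ((∑ i ∈ s, f i : ENNReal) : EReal) = ∑ i ∈ s, (f i : EReal) := by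
  induction s using Finset.induction_on with
  | empty => simp
  | insert i s hi ih => rw [Finset.sum_insert hi, Finset.sum_insert hi, EReal.coe_ennreal_add, ih]

lemma mul_infoDiv {α : Type*} [Fintype α] {c : ℝ} (hc : 0 < c) {M' M : α → ℝ}
    (hM' : ∀ a, 0 ≤ M' a) (hM : ∀ a, 0 ≤ M a) :
    (c : EReal) * infoDiv M' M = ((∑ a, klTerm (c * M' a) (c * M a) : ENNReal) : EReal) := by
  unfold infoDiv
  split_ifs with h
  · have hterm : ∀ a, klTerm (c * M' a) (c * M a) =
        ENNReal.ofReal (c * (M' a * Real.log (M' a / M a) - M' a + M a)) := fun a => by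
      rw [klTerm_of_imp (mul_nonneg hc.le (hM' a)) (mul_nonneg hc.le (hM a)),
        mul_div_mul_left _ _ hc.ne']
      · ring_nf
      · intro h0
        rw [h a ((mul_eq_zero.1 h0).resolve_left hc.ne'), mul_zero]
    have hnonneg : ∀ a, 0 ≤ c * (M' a * Real.log (M' a / M a) - M' a + M a) := fun a =>
      mul_nonneg hc.le (log_div_term_nonneg (hM' a) (hM a) (h a))
    rw [Finset.sum_congr rfl fun a _ => hterm a,
      ← ENNReal.ofReal_sum_of_nonneg fun a _ => hnonneg a, EReal.coe_ennreal_ofReal,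
      max_eq_left (Finset.sum_nonneg fun a _ => hnonneg a), ← EReal.coe_mul, Finset.mul_sum]
  · push Not at h
    obtain ⟨a, ha, ha'⟩ := h
    have hpos : 0 < M' a := (hM' a).lt_of_ne' ha'
    have htop : ∑ a, klTerm (c * M' a) (c * M a) = ⊤ :=
      ENNReal.sum_eq_top.2 ⟨a, Finset.mem_univ a, by
        rw [ha, mul_zero, klTerm_zero_right (mul_pos hc hpos)]⟩
    rw [htop, EReal.coe_mul_top_of_pos hc, EReal.coe_ennreal_top]

lemma tendsto_mix_bound {K L : ENNReal} (hK : K ≠ ⊤) (hL : L ≠ ⊤) :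
    Tendsto (fun t : ℝ => ENNReal.ofReal (1 - t) * K + ENNReal.ofReal t * L)
      (nhdsWithin 0 (Set.Ioi 0)) (nhds K) := by
  have h : Tendsto (fun t : ℝ => ENNReal.ofReal (1 - t) * K + ENNReal.ofReal t * L)
      (nhds 0) (nhds (ENNReal.ofReal (1 - 0) * K + ENNReal.ofReal 0 * L)) := by
    refine Tendsto.add (ENNReal.Tendsto.mul_const ?_ (Or.inr hK))
      (ENNReal.Tendsto.mul_const ?_ (Or.inr hL))
    · exact ENNReal.tendsto_ofReal (tendsto_const_nhds.sub tendsto_id)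
    · exact ENNReal.tendsto_ofReal tendsto_id
  simp only [sub_zero, ENNReal.ofReal_one, one_mul, ENNReal.ofReal_zero, zero_mul,
    add_zero] at h
  exact h.mono_left nhdsWithin_le_nhds

lemma tendsto_klTerm {α : Type*} {l : Filter α} {f g : α → ℝ} {a b : ℝ} (ha : 0 ≤ a)
    (hb : 0 < b) (hf : Tendsto f l (nhds a)) (hg : Tendsto g l (nhds b))
    (hf0 : ∀ᶠ i in l, 0 ≤ f i) :
    Tendsto (fun i => klTerm (f i) (g i)) l (nhds (klTerm a b)) := by
  have hlim : Tendsto (fun i => (f i, g i)) l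
      (nhdsWithin (a, b) {q : ℝ × ℝ | 0 ≤ q.1 ∧ 0 < q.2}) :=
    tendsto_nhdsWithin_iff.2 ⟨hf.prodMk_nhds hg, hf0.and (hg.eventually (lt_mem_nhds hb))⟩
  have hkl : Tendsto (fun q : ℝ × ℝ => klTerm q.1 q.2)
      (nhdsWithin (a, b) {q : ℝ × ℝ | 0 ≤ q.1 ∧ 0 < q.2}) (nhds (klTerm a b)) :=
    continuousOn_klTerm (a, b) ⟨ha, hb⟩
  have h := hkl.comp hlim
  simpa only [Function.comp_def] using h

section Dist

variable {R X : Type*} [Fintype R] [Fintype X]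

/-- The objective of the distance function when `x₀` is the only optimal arm. -/
noncomputable def cost (x₀ : X) (η : X → ℝ) (P Q : RMat R X) : ENNReal :=
  ∑ x ∈ Finset.univ.erase x₀, ∑ r, klTerm (η x * P r x) (η x * Q r x)

/-- The deceitful reward distributions when `x₀` is the only optimal arm. -/
def deceitAt (v : R → ℝ) (PP : Set (RMat R X)) (x₀ x' : X) (P : RMat R X) : Set (RMat R X) :=
  {Q | Q ∈ PP ∧ (∀ r, Q r x₀ = P r x₀) ∧ rewOf v Q x₀ < rewOf v Q x'}

/-- The convex combination `(1 - t) A + t B`. -/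
def mix (t : ℝ) (A B : RMat R X) : RMat R X := fun r x => (1 - t) * A r x + t * B r x

omit [Fintype R] [Fintype X] in
lemma mix_mem {PP : Set (RMat R X)} (hconv : Convex ℝ PP) {A B : RMat R X} (hA : A ∈ PP)
    (hB : B ∈ PP) {t : ℝ} (ht0 : 0 ≤ t) (ht1 : t ≤ 1) : mix t A B ∈ PP :=
  hconv hA hB (sub_nonneg.2 ht1) ht0 (by ring)

omit [Fintype X] in
lemma rewOf_mix (v : R → ℝ) (t : ℝ) (A B : RMat R X) (x : X) :
    rewOf v (mix t A B) x = (1 - t) * rewOf v A x + t * rewOf v B x := by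
  simp only [rewOf, mix, Finset.mul_sum, ← Finset.sum_add_distrib]
  exact Finset.sum_congr rfl fun r _ => by ring

omit [Fintype X] in
lemma continuous_rewOf (v : R → ℝ) (x : X) : Continuous fun Q : RMat R X => rewOf v Q x := by
  unfold rewOf
  fun_prop

lemma lowerSemicontinuous_cost (x₀ : X) :
    LowerSemicontinuous fun p : ((X → ℝ) × RMat R X) × RMat R X => cost x₀ p.1.1 p.1.2 p.2 := by
  refine lowerSemicontinuous_sum fun x _ => lowerSemicontinuous_sum fun r _ => ?_
  exact lowerSemicontinuous_klTerm.comp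
    (g := fun p : ((X → ℝ) × RMat R X) × RMat R X =>
      (p.1.1 x * p.1.2 r x, p.1.1 x * p.2 r x)) (by fun_prop)

lemma cost_mix_le (x₀ : X) (η : X → ℝ) (P A B : RMat R X) {t : ℝ} (ht0 : 0 ≤ t) (ht1 : t ≤ 1) :
    cost x₀ η P (mix t A B) ≤
      ENNReal.ofReal (1 - t) * cost x₀ η P A + ENNReal.ofReal t * cost x₀ η P B := by
  simp only [cost, Finset.mul_sum, ← Finset.sum_add_distrib]
  refine Finset.sum_le_sum fun x _ => Finset.sum_le_sum fun r _ => ?_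
  have h : η x * mix t A B r x = (1 - t) * (η x * A r x) + t * (η x * B r x) := by
    simp only [mix]
    ring
  rw [h]
  exact klTerm_convex_right _ _ _ ht0 ht1

lemma cost_ne_top {x₀ : X} {η : X → ℝ} (hη : ∀ x, 0 < η x) {P Q : RMat R X}
    (hP : ∀ r x, 0 ≤ P r x) (hQ : ∀ r x, x ≠ x₀ → 0 < Q r x) : cost x₀ η P Q ≠ ⊤ := by
  refine ENNReal.sum_ne_top.2 fun x hx => ENNReal.sum_ne_top.2 fun r _ => ?_
  exact klTerm_ne_top (mul_nonneg (hη x).le (hP r x))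
    (mul_pos (hη x) (hQ r x (Finset.ne_of_mem_erase hx)))

lemma tendsto_cost {x₀ : X} {η₀ : X → ℝ} (hη₀ : ∀ x, 0 < η₀ x) {PP : Set (RMat R X)}
    (hsub : PP ⊆ POmega) {P Q : RMat R X} (hP : P ∈ PP) (hQ : ∀ r x, x ≠ x₀ → 0 < Q r x) :
    Tendsto (fun p : (X → ℝ) × RMat R X => cost x₀ p.1 p.2 Q)
      (nhdsWithin (η₀, P) (Set.univ ×ˢ PP)) (nhds (cost x₀ η₀ P Q)) := by
  unfold cost
  refine tendsto_finsetSum _ fun x hx => tendsto_finsetSum _ fun r _ => ?_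
  have hη : Tendsto (fun p : (X → ℝ) × RMat R X => p.1 x)
      (nhdsWithin (η₀, P) (Set.univ ×ˢ PP)) (nhds (η₀ x)) :=
    (((continuous_apply x).comp continuous_fst).tendsto (η₀, P)).mono_left nhdsWithin_le_nhds
  have hPr : Tendsto (fun p : (X → ℝ) × RMat R X => p.2 r x)
      (nhdsWithin (η₀, P) (Set.univ ×ˢ PP)) (nhds (P r x)) :=
    (((continuous_apply_apply r x).comp continuous_snd).tendsto (η₀, P)).mono_left
      nhdsWithin_le_nhds
  refine tendsto_klTerm (mul_nonneg (hη₀ x).le ((hsub hP).1 r x))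
    (mul_pos (hη₀ x) (hQ r x (Finset.ne_of_mem_erase hx))) (hη.mul hPr) (hη.mul_const _) ?_
  filter_upwards [hη.eventually (lt_mem_nhds (hη₀ x)), self_mem_nhdsWithin] with p hp hpP
  exact mul_nonneg hp.le ((hsub hpP.2).1 r x)

omit [Fintype X] in
/-- An interior distribution can be perturbed, off a given arm, to have full support. -/
lemma exists_pos_perturbation {O : Set (RMat R X)} (hO : IsOpen O) {P : RMat R X} (hPO : P ∈ O)
    (hP : P ∈ POmega) (x₀ : X) :
    ∃ U ∈ O, U ∈ POmega ∧ (∀ r, U r x₀ = P r x₀) ∧ ∀ r x, x ≠ x₀ → 0 < U r x := by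
  have hcard : (0 : ℝ) < Fintype.card R := by
    have : Nonempty R := by
      by_contra h
      rw [not_nonempty_iff] at h
      simpa using hP.2 x₀
    exact_mod_cast Fintype.card_pos
  let B : RMat R X := fun r x => if x = x₀ then P r x else 1 / Fintype.card R
  have hcont : Continuous fun t : ℝ => mix t P B := by
    unfold mix
    fun_prop
  have h0 : mix 0 P B = P := by
    funext r x
    simp [mix]
  have hev : ∀ᶠ t in nhdsWithin (0 : ℝ) (Set.Ioi 0), mix t P B ∈ O :=
    nhdsWithin_le_nhds ((hcont.tendsto' 0 P h0).eventually (hO.mem_nhds hPO))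
  obtain ⟨t, htO, ht0, ht1⟩ := (hev.and (Ioo_mem_nhdsGT (zero_lt_one' ℝ))).exists
  have hB : ∀ r x, x ≠ x₀ → 0 < B r x := fun r x hx => by
    simp only [B, if_neg hx]
    positivity
  have hPnn := hP.1
  refine ⟨mix t P B, htO, ⟨fun r x => ?_, fun x => ?_⟩, fun r => ?_, fun r x hx => ?_⟩
  · by_cases hx : x = x₀
    · have : mix t P B r x = P r x := by
        simp only [mix, B, if_pos hx]
        ring
      rw [this]
      exact hPnn r x
    · exact add_nonneg (mul_nonneg (by linarith) (hPnn r x)) (mul_pos ht0 (hB r x hx)).le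
  · simp only [mix, Finset.sum_add_distrib, ← Finset.mul_sum, hP.2 x]
    by_cases hx : x = x₀
    · simp only [B, if_pos hx, hP.2 x]
      ring
    · simp only [B, if_neg hx, Finset.sum_const, Finset.card_univ, nsmul_eq_mul]
      field_simp
      ring
  · simp only [mix, B, if_true]
    ring
  · exact add_pos_of_nonneg_of_pos (mul_nonneg (by linarith) (hPnn r x))
      (mul_pos ht0 (hB r x hx))

omit [Fintype X] in
lemma eventually_rewOf_mix_lt {v : R → ℝ} {x₀ x' : X} {A : RMat R X}
    (h : rewOf v A x₀ < rewOf v A x') (B : RMat R X) :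
    ∀ᶠ t in nhdsWithin (0 : ℝ) (Set.Ioi 0), rewOf v (mix t A B) x₀ < rewOf v (mix t A B) x' := by
  have hlt : ∀ᶠ t in nhds (0 : ℝ), (1 - t) * rewOf v A x₀ + t * rewOf v B x₀ <
      (1 - t) * rewOf v A x' + t * rewOf v B x' :=
    (isOpen_lt (by fun_prop) (by fun_prop)).mem_nhds (by simpa using h)
  filter_upwards [nhdsWithin_le_nhds hlt] with t ht
  rwa [rewOf_mix, rewOf_mix]

omit [Fintype X] in
/-- Around an interior distribution, `mix t A U` can be moved inside `𝒫` so as to agree with a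
nearby distribution `Q` at `x₀`, without changing the other arms. -/
lemma eventually_exists_mem_eq_off {PP O : Set (RMat R X)} (hsub : PP ⊆ POmega)
    (hconv : Convex ℝ PP) (hO : IsOpen O) (hOPP : O ∩ POmega ⊆ PP) {P A U : RMat R X} {x₀ : X}
    (hP : P ∈ POmega) (hA : A ∈ PP) (hAx₀ : ∀ r, A r x₀ = P r x₀) (hUO : U ∈ O)
    (hU : U ∈ POmega) (hUx₀ : ∀ r, U r x₀ = P r x₀) {t : ℝ} (ht0 : 0 < t) (ht1 : t < 1) :
    ∀ᶠ Q in nhdsWithin P PP, ∃ W ∈ PP, (∀ r, W r x₀ = Q r x₀) ∧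
      ∀ r x, x ≠ x₀ → W r x = mix t A U r x := by
  let V : RMat R X → RMat R X := fun Q r x =>
    if x = x₀ then P r x + (Q r x - P r x) / t else U r x
  have hV : Continuous V := by
    refine continuous_pi fun r => continuous_pi fun x => ?_
    by_cases hx : x = x₀
    · simp only [V, if_pos hx]
      fun_prop
    · simp only [V, if_neg hx]
      fun_prop
  have hVP : V P = U := by
    funext r x
    by_cases hx : x = x₀
    · simp [V, hx, hUx₀]
    · simp [V, hx]
  have hVO : ∀ᶠ Q in nhds P, V Q ∈ O :=
    (hV.tendsto' P U hVP).eventually (hO.mem_nhds hUO)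
  have hnn : ∀ᶠ Q in nhds P, ∀ r, 0 < P r x₀ → 0 < P r x₀ + (Q r x₀ - P r x₀) / t := by
    refine eventually_all.2 fun r => ?_
    by_cases hr : 0 < P r x₀
    · have : ∀ᶠ Q : RMat R X in nhds P, 0 < P r x₀ + (Q r x₀ - P r x₀) / t :=
        (isOpen_lt (by fun_prop) (by fun_prop)).mem_nhds (by simpa using hr)
      filter_upwards [this] with Q hQ _ using hQ
    · exact Eventually.of_forall fun Q h => absurd h hr
  filter_upwards [nhdsWithin_le_nhds hVO, nhdsWithin_le_nhds hnn, self_mem_nhdsWithin]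
    with Q hQO hQnn hQ
  have hVmem : V Q ∈ POmega := by
    refine ⟨fun r x => ?_, fun x => ?_⟩
    · by_cases hx : x = x₀
      · subst hx
        simp only [V, if_true]
        rcases (hP.1 r x).eq_or_lt with h | h
        · rw [← h]
          simpa using div_nonneg ((hsub hQ).1 r x) ht0.le
        · exact (hQnn r h).le
      · simpa [V, hx] using hU.1 r x
    · by_cases hx : x = x₀
      · simp only [V, if_pos hx, Finset.sum_add_distrib, ← Finset.sum_div,
          Finset.sum_sub_distrib, hP.2 x, (hsub hQ).2 x]
        simp
      · simpa [V, hx] using hU.2 x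
  refine ⟨mix t A (V Q), mix_mem hconv hA (hOPP ⟨hQO, hVmem⟩) ht0.le ht1.le, fun r => ?_,
    fun r x hx => ?_⟩
  · simp only [mix, V, if_true, hAx₀]
    field_simp
    ring
  · simp only [mix, V, if_neg hx]

end Dist

section Main

variable {R X : Type*} [Fintype R] [Fintype X] [Nonempty X]

lemma distFn_eq {v : R → ℝ} {PP : Set (RMat R X)} (hsub : PP ⊆ POmega) {η : X → ℝ}
    (hη : ∀ x, 0 < η x) {P : RMat R X} (hP : P ∈ PP) {x₀ : X} (hopt : optArms v P = {x₀})
    (x' : X) :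
    DistFn v PP η x' P = ⨅ Q ∈ deceitAt v PP x₀ x' P, (cost x₀ η P Q : EReal) := by
  have hset : DeceitSet v PP x' P = deceitAt v PP x₀ x' P := by
    simp only [DeceitSet, deceitAt, hopt, Set.mem_singleton_iff, forall_eq]
  have hfin : subFinset v P = Finset.univ.erase x₀ := by
    ext x
    have := Set.ext_iff.1 hopt x
    simp only [optArms, Set.mem_ofPred_eq, Set.mem_singleton_iff] at this
    simp [subFinset, this]
  rw [DistFn, sInf_image, hset]
  refine iInf_congr fun Q => iInf_congr fun hQ => ?_
  rw [distObj, cost, coe_ennreal_sum, hfin]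
  exact Finset.sum_congr rfl fun x _ =>
    mul_infoDiv (hη x) (fun r => (hsub hP).1 r x) (fun r => (hsub hQ.1).1 r x)

lemma eventually_optArms_eq {v : R → ℝ} {P : RMat R X} {x₀ : X} (hopt : optArms v P = {x₀}) :
    ∀ᶠ Q in nhds P, optArms v Q = {x₀} := by
  have hstar : rewOf v P x₀ = rewStar v P := by
    have : x₀ ∈ optArms v P := hopt ▸ rfl
    exact this
  have hlt : ∀ x, x ≠ x₀ → rewOf v P x < rewOf v P x₀ := fun x hx => by
    refine lt_of_le_of_ne (hstar ▸ Finset.le_sup' _ (Finset.mem_univ x)) fun h => hx ?_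
    have : x ∈ optArms v P := h.trans hstar
    simpa [hopt] using this
  have hev : ∀ᶠ Q in nhds P, ∀ x, x ≠ x₀ → rewOf v Q x < rewOf v Q x₀ := by
    rw [eventually_all]
    intro x
    by_cases hx : x = x₀
    · exact Eventually.of_forall fun Q h => absurd hx h
    · filter_upwards [(isOpen_lt (continuous_rewOf v x) (continuous_rewOf v x₀)).mem_nhds
        (hlt x hx)] with Q hQ _ using hQ
  filter_upwards [hev] with Q hQ
  have hQstar : rewStar v Q = rewOf v Q x₀ := by
    refine le_antisymm (Finset.sup'_le _ _ fun x _ => ?_)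
      (Finset.le_sup' _ (Finset.mem_univ x₀))
    by_cases hx : x = x₀
    · rw [hx]
    · exact (hQ x hx).le
  ext x
  simp only [optArms, hQstar, Set.mem_ofPred_eq, Set.mem_singleton_iff]
  exact ⟨fun h => by_contra fun hx => (hQ x hx).ne h, fun h => h ▸ rfl⟩

/-- Weakly deceitful distributions already dominate the distance, as soon as there is some
deceitful distribution of full support. -/
lemma distFn_le_cost {v : R → ℝ} {PP : Set (RMat R X)} (hsub : PP ⊆ POmega)
    (hconv : Convex ℝ PP) {η : X → ℝ} (hη : ∀ x, 0 < η x) {P : RMat R X} (hP : P ∈ PP)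
    {x₀ x' : X} (hopt : optArms v P = {x₀}) {D : RMat R X} (hD : D ∈ deceitAt v PP x₀ x' P)
    (hDpos : ∀ r x, x ≠ x₀ → 0 < D r x) {Q : RMat R X} (hQ : Q ∈ PP)
    (hQx₀ : ∀ r, Q r x₀ = P r x₀) (hQle : rewOf v Q x₀ ≤ rewOf v Q x') :
    DistFn v PP η x' P ≤ (cost x₀ η P Q : EReal) := by
  by_cases hK : cost x₀ η P Q = ⊤
  · simp [hK]
  have hlim := (continuous_coe_ennreal_ereal.tendsto _).comp
    (tendsto_mix_bound hK (cost_ne_top hη (hsub hP).1 hDpos))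
  refine ge_of_tendsto hlim ?_
  filter_upwards [Ioo_mem_nhdsGT (zero_lt_one' ℝ)] with t ht
  have hmem : mix t Q D ∈ deceitAt v PP x₀ x' P := by
    refine ⟨mix_mem hconv hQ hD.1 ht.1.le ht.2.le, fun r => ?_, ?_⟩
    · simp only [mix, hQx₀, hD.2.1]
      ring
    · rw [rewOf_mix, rewOf_mix]
      exact add_lt_add_of_le_of_lt (mul_le_mul_of_nonneg_left hQle (sub_nonneg.2 ht.2.le))
        (mul_lt_mul_of_pos_left hD.2.2 ht.1)
  rw [distFn_eq hsub hη hP hopt]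
  exact (iInf₂_le _ hmem).trans
    (EReal.coe_ennreal_le_coe_ennreal_iff.2 (cost_mix_le x₀ η P Q D ht.1.le ht.2.le))

lemma exists_pos_deceit {v : R → ℝ} {PP : Set (RMat R X)} (hsub : PP ⊆ POmega)
    (hconv : Convex ℝ PP) {P : RMat R X} (hP : P ∈ PP) {x₀ x' : X}
    (hopt : optArms v P = {x₀}) (hx' : x' ∈ deceitArms v PP P) {U : RMat R X} (hU : U ∈ PP)
    (hUx₀ : ∀ r, U r x₀ = P r x₀) (hUpos : ∀ r x, x ≠ x₀ → 0 < U r x) :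
    ∃ D ∈ deceitAt v PP x₀ x' P, ∀ r x, x ≠ x₀ → 0 < D r x := by
  have hstar : rewOf v P x₀ = rewStar v P := by
    have : x₀ ∈ optArms v P := hopt ▸ rfl
    exact this
  have hnonempty : {c : ℝ | ∃ Q ∈ PP, (∀ x ∈ optArms v P, ∀ r, Q r x = P r x) ∧
      c = rewOf v Q x'}.Nonempty := ⟨rewOf v P x', P, hP, fun _ _ _ => rfl, rfl⟩
  obtain ⟨_, ⟨A, hA, hAeq, rfl⟩, hlt⟩ := exists_lt_of_lt_csSup hnonempty hx'.2
  have hAx₀ : ∀ r, A r x₀ = P r x₀ := hAeq x₀ (hopt ▸ rfl)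
  have hAlt : rewOf v A x₀ < rewOf v A x' := by
    have : rewOf v A x₀ = rewOf v P x₀ := by simp only [rewOf, hAx₀]
    rwa [this, hstar]
  obtain ⟨t, hlt, ht0, ht1⟩ :=
    ((eventually_rewOf_mix_lt hAlt U).and (Ioo_mem_nhdsGT (zero_lt_one' ℝ))).exists
  refine ⟨mix t A U, ⟨mix_mem hconv hA hU ht0.le ht1.le, fun r => ?_, hlt⟩, fun r x hx => ?_⟩
  · simp only [mix, hAx₀, hUx₀]
    ring
  · exact add_pos_of_nonneg_of_pos (mul_nonneg (by linarith) ((hsub hA).1 r x))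
      (mul_pos ht0 (hUpos r x hx))

lemma eventually_distFn_eq {v : R → ℝ} {PP : Set (RMat R X)} (hsub : PP ⊆ POmega)
    {η₀ : X → ℝ} (hη₀ : ∀ x, 0 < η₀ x) {P : RMat R X} {x₀ : X}
    (hopt : optArms v P = {x₀}) (x' : X) :
    ∀ᶠ p : (X → ℝ) × RMat R X in nhdsWithin (η₀, P) (Set.univ ×ˢ PP),
      DistFn v PP p.1 x' p.2 = ⨅ Q ∈ deceitAt v PP x₀ x' p.2, (cost x₀ p.1 p.2 Q : EReal) := by
  have hpos : ∀ᶠ p : (X → ℝ) × RMat R X in nhds (η₀, P), ∀ x, 0 < p.1 x :=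
    eventually_all.2 fun x => (isOpen_lt continuous_const
      ((continuous_apply x).comp continuous_fst)).mem_nhds (hη₀ x)
  have hopt' : ∀ᶠ p : (X → ℝ) × RMat R X in nhds (η₀, P), optArms v p.2 = {x₀} :=
    (continuous_snd.tendsto (η₀, P)).eventually (eventually_optArms_eq hopt)
  filter_upwards [nhdsWithin_le_nhds hpos, nhdsWithin_le_nhds hopt', self_mem_nhdsWithin]
    with p h1 h2 h3
  exact distFn_eq hsub h1 h3.2 h2 x'

/-- Lower semicontinuity of the distance function, from compactness. -/
lemma eventually_lt_distFn {v : R → ℝ} {PP : Set (RMat R X)} (hsub : PP ⊆ POmega)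
    (hconv : Convex ℝ PP) (hcomp : IsCompact PP) {η₀ : X → ℝ} (hη₀ : ∀ x, 0 < η₀ x)
    {P : RMat R X} (hP : P ∈ PP) {x₀ x' : X} (hopt : optArms v P = {x₀}) {D : RMat R X}
    (hD : D ∈ deceitAt v PP x₀ x' P) (hDpos : ∀ r x, x ≠ x₀ → 0 < D r x) {c : EReal}
    (hc : c < DistFn v PP η₀ x' P) :
    ∀ᶠ p : (X → ℝ) × RMat R X in nhdsWithin (η₀, P) (Set.univ ×ˢ PP),
      c < DistFn v PP p.1 x' p.2 := by
  obtain ⟨c', hcc', hc'⟩ := exists_between hc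
  have hcost : LowerSemicontinuous fun p : ((X → ℝ) × RMat R X) × RMat R X =>
      (cost x₀ p.1.1 p.1.2 p.2 : EReal) :=
    continuous_coe_ennreal_ereal.comp_lowerSemicontinuous (lowerSemicontinuous_cost x₀)
      fun _ _ h => EReal.coe_ennreal_le_coe_ennreal_iff.2 h
  have hclosed : IsClosed {p : ((X → ℝ) × RMat R X) × RMat R X |
      (∀ r, p.2 r x₀ = p.1.2 r x₀) ∧ rewOf v p.2 x₀ ≤ rewOf v p.2 x'} := by
    refine IsClosed.and ?_ (isClosed_le ((continuous_rewOf v x₀).comp continuous_snd)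
      ((continuous_rewOf v x').comp continuous_snd))
    simp only [Set.ofPred_forall]
    exact isClosed_iInter fun r => isClosed_eq (by fun_prop) (by fun_prop)
  have htube : ∀ᶠ p : (X → ℝ) × RMat R X in nhds (η₀, P), ∀ Q ∈ PP,
      ((∀ r, Q r x₀ = p.2 r x₀) ∧ rewOf v Q x₀ ≤ rewOf v Q x') →
        c' ≤ (cost x₀ p.1 p.2 Q : EReal) := by
    refine hcomp.eventually_forall_of_forall_eventually
      (P := fun (p : (X → ℝ) × RMat R X) (Q : RMat R X) =>
      ((∀ r, Q r x₀ = p.2 r x₀) ∧ rewOf v Q x₀ ≤ rewOf v Q x') →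
        c' ≤ (cost x₀ p.1 p.2 Q : EReal)) fun Q hQ => ?_
    by_cases hQw : (∀ r, Q r x₀ = P r x₀) ∧ rewOf v Q x₀ ≤ rewOf v Q x'
    · have hlt := hc'.trans_le
        (distFn_le_cost hsub hconv hη₀ hP hopt hD hDpos hQ hQw.1 hQw.2)
      filter_upwards [hcost ((η₀, P), Q) c' hlt] with p hp _ using hp.le
    · filter_upwards [hclosed.isOpen_compl.mem_nhds
        (show ((η₀, P), Q) ∈ {p : ((X → ℝ) × RMat R X) × RMat R X |
          (∀ r, p.2 r x₀ = p.1.2 r x₀) ∧ rewOf v p.2 x₀ ≤ rewOf v p.2 x'}ᶜ from hQw)]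
        with p hp h
      exact absurd h hp
  filter_upwards [eventually_distFn_eq hsub hη₀ hopt x', nhdsWithin_le_nhds htube] with p hp h
  rw [hp]
  exact hcc'.trans_le (le_iInf₂ fun Q hQ => h Q hQ.1 ⟨hQ.2.1, hQ.2.2.le⟩)

/-- Upper semicontinuity of the distance function at interior distributions. -/
lemma eventually_distFn_lt {v : R → ℝ} {PP O : Set (RMat R X)} (hsub : PP ⊆ POmega)
    (hconv : Convex ℝ PP) (hO : IsOpen O) (hOPP : O ∩ POmega ⊆ PP) {η₀ : X → ℝ}
    (hη₀ : ∀ x, 0 < η₀ x) {P U : RMat R X} (hP : P ∈ PP) {x₀ x' : X}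
    (hopt : optArms v P = {x₀}) (hx' : x' ≠ x₀) (hUO : U ∈ O) (hU : U ∈ POmega)
    (hUx₀ : ∀ r, U r x₀ = P r x₀) (hUpos : ∀ r x, x ≠ x₀ → 0 < U r x) {c : EReal}
    (hc : DistFn v PP η₀ x' P < c) :
    ∀ᶠ p : (X → ℝ) × RMat R X in nhdsWithin (η₀, P) (Set.univ ×ˢ PP),
      DistFn v PP p.1 x' p.2 < c := by
  rw [distFn_eq hsub hη₀ hP hopt] at hc
  simp only [iInf_lt_iff] at hc
  obtain ⟨A, ⟨hA, hAx₀, hAlt⟩, hAc⟩ := hc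
  have hK : cost x₀ η₀ P A ≠ ⊤ := fun h => by simp [h] at hAc
  have hbound : ∀ᶠ t in nhdsWithin (0 : ℝ) (Set.Ioi 0),
      ((ENNReal.ofReal (1 - t) * cost x₀ η₀ P A + ENNReal.ofReal t * cost x₀ η₀ P U : ENNReal) :
        EReal) < c :=
    ((continuous_coe_ennreal_ereal.tendsto _).comp
      (tendsto_mix_bound hK (cost_ne_top hη₀ (hsub hP).1 hUpos))).eventually (gt_mem_nhds hAc)
  obtain ⟨t, hbt, hlt, ht0, ht1⟩ := (hbound.and
    ((eventually_rewOf_mix_lt hAlt U).and (Ioo_mem_nhdsGT (zero_lt_one' ℝ)))).exists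
  have hMpos : ∀ r x, x ≠ x₀ → 0 < mix t A U r x := fun r x hx =>
    add_pos_of_nonneg_of_pos (mul_nonneg (by linarith) ((hsub hA).1 r x))
      (mul_pos ht0 (hUpos r x hx))
  have hMc : (cost x₀ η₀ P (mix t A U) : EReal) < c :=
    (EReal.coe_ennreal_le_coe_ennreal_iff.2
      (cost_mix_le x₀ η₀ P A U ht0.le ht1.le)).trans_lt hbt
  have hcost := ((continuous_coe_ennreal_ereal.tendsto _).comp
    (tendsto_cost hη₀ hsub hP hMpos)).eventually (gt_mem_nhds hMc)
  have hMx₀ : rewOf v (mix t A U) x₀ = rewOf v P x₀ := by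
    rw [rewOf_mix]
    simp only [rewOf, hAx₀, hUx₀]
    ring
  have hlt' : ∀ᶠ Q in nhdsWithin P PP, rewOf v Q x₀ < rewOf v (mix t A U) x' :=
    nhdsWithin_le_nhds ((isOpen_lt (continuous_rewOf v x₀) continuous_const).mem_nhds
      (show rewOf v P x₀ < rewOf v (mix t A U) x' from hMx₀ ▸ hlt))
  have hsnd : Tendsto Prod.snd (nhdsWithin (η₀, P) (Set.univ ×ˢ PP)) (nhdsWithin P PP) :=
    tendsto_nhdsWithin_iff.2 ⟨(continuous_snd.tendsto (η₀, P)).mono_left nhdsWithin_le_nhds,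
      eventually_mem_nhdsWithin.mono fun p hp => hp.2⟩
  have hW := eventually_exists_mem_eq_off hsub hconv hO hOPP (hsub hP) hA hAx₀ hUO hU hUx₀
    ht0 ht1
  filter_upwards [eventually_distFn_eq hsub hη₀ hopt x', hcost, hsnd.eventually hlt',
    hsnd.eventually hW] with p hp hpc hplt ⟨W, hWPP, hWx₀, hWoff⟩
  have hWmem : W ∈ deceitAt v PP x₀ x' p.2 := by
    refine ⟨hWPP, hWx₀, ?_⟩
    have h1 : rewOf v W x₀ = rewOf v p.2 x₀ := by simp only [rewOf, hWx₀]
    have h2 : rewOf v W x' = rewOf v (mix t A U) x' := by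
      simp only [rewOf, hWoff _ x' hx']
    rwa [h1, h2]
  have hWcost : cost x₀ p.1 p.2 W = cost x₀ p.1 p.2 (mix t A U) :=
    Finset.sum_congr rfl fun x hx => Finset.sum_congr rfl fun r _ => by
      rw [hWoff r x (Finset.ne_of_mem_erase hx)]
  rw [hp]
  refine (iInf₂_le W hWmem).trans_lt ?_
  rw [hWcost]
  exact hpc

end Main

/-- continuity of the distance function:
if `P` lies in the (relative) interior of `𝒫` and has a unique optimal arm, and
`x' ∈ X̃_d(P)` is a deceitful arm of `P`, then `(η, Q) ↦ Dist(η, x', Q)` is continuous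
(within exploration rates and distributions in `𝒫`) at every point `(η₀, P)` with
`η₀ > 0` componentwise. -/
theorem dist_continuity
    {R X : Type*} [Fintype R] [Fintype X] [Nonempty X]
    (v : R → ℝ) (hv : ∀ r, 0 ≤ v r)
    (PP : Set (RMat R X)) (hsub : PP ⊆ POmega) (hconv : Convex ℝ PP)
    (hcomp : IsCompact PP) (hne : (relIntIn POmega PP).Nonempty)
    (P : RMat R X) (hPint : P ∈ relIntIn POmega PP)
    (huniq : ∃ x₀ : X, optArms v P = {x₀})
    (x' : X) (hx' : x' ∈ deceitArms v PP P)
    (η₀ : X → ℝ) (hη₀ : ∀ x, 0 < η₀ x) :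
    ContinuousWithinAt (fun p : (X → ℝ) × RMat R X => DistFn v PP p.1 x' p.2)
      (Set.univ ×ˢ PP) (η₀, P) := by
  obtain ⟨x₀, hopt⟩ := huniq
  obtain ⟨hP, O, hO, hPO, hOPP⟩ := hPint
  obtain ⟨U, hUO, hU, hUx₀, hUpos⟩ := exists_pos_perturbation hO hPO (hsub hP) x₀
  obtain ⟨D, hD, hDpos⟩ :=
    exists_pos_deceit hsub hconv hP hopt hx' (hOPP ⟨hUO, hU⟩) hUx₀ hUpos
  have hne' : x' ≠ x₀ := by
    rintro rfl
    have : x' ∈ optArms v P := hopt ▸ rfl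
    exact hx'.1 this
  exact tendsto_order.2
    ⟨fun _ hc => eventually_lt_distFn hsub hconv hcomp hη₀ hP hopt hD hDpos hc,
      fun _ hc => eventually_distFn_lt hsub hconv hO hOPP hη₀ hP hopt hne' hUO hU hUx₀ hUpos hc⟩

end Bandit
end
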